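/- arXiv:2502.18582 — 5 statements merged into one kernel-verified Lean document; each statement's English description precedes it below -/
import Mathlib

section
/- Let X ⊆ ℝ^d be a nonempty, convex, compact set and let φ : X → X be an arbitrary function (no continuity assumed). Then the zero vector lies in the convex hull of the set {φ(x) − x : x ∈ X}; equivalently, there exist finitely many points x₁,…,x_m ∈ X and weights λ₁,…,λ_m ≥ 0 with Σ_j λ_j = 1 such that Σ_j λ_j (φ(x_j) − x_j) = 0. In other words, every endomorphism of X admits an exact expected fixed point. -/
open scoped RealInnerProductSpace

section Separation

variable {E : Type*} [NormedAddCommGroup E] [InnerProductSpace ℝ E]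

/-- A nonempty compact convex set missing the origin contains a vector with positive inner
product against every element of the set. -/
lemma Convex.exists_mem_forall_inner_pos {K : Set E} (hK : Convex ℝ K) (hc : IsCompact K)
    (hne : K.Nonempty) (h0 : (0 : E) ∉ K) : ∃ v ∈ K, ∀ w ∈ K, 0 < ⟪v, w⟫ := by
  obtain ⟨v, hv, hmin⟩ := exists_norm_eq_iInf_of_complete_convex hne hc.isComplete hK 0
  refine ⟨v, hv, fun w hw => ?_⟩
  have h := (norm_eq_iInf_iff_real_inner_le_zero hK hv).1 hmin w hw
  have hv0 : v ≠ 0 := fun h => h0 (h ▸ hv)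
  have hpos : 0 < ⟪v, v⟫ := real_inner_self_pos.2 hv0
  rw [zero_sub, inner_neg_left, inner_sub_right] at h
  linarith

/-- A nonempty subset of a finite-dimensional subspace `W` whose convex hull misses the origin lies
in a closed half-space bounded by the hyperplane orthogonal to a nonzero vector of `W`. -/
lemma exists_ne_zero_forall_inner_nonneg [FiniteDimensional ℝ E] {S : Set E} (hS : S.Nonempty)
    (W : Submodule ℝ E) (hSW : S ⊆ W) (h0 : (0 : E) ∉ convexHull ℝ S) :
    ∃ v ∈ W, v ≠ 0 ∧ ∀ w ∈ S, 0 ≤ ⟪v, w⟫ := by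
  have hcomp : IsCompact (Metric.sphere (0 : E) 1 ∩ W) :=
    (isCompact_sphere 0 1).inter_right W.closed_of_finiteDimensional
  obtain ⟨v, ⟨hv1, hvW⟩, hv⟩ := hcomp.inter_iInter_nonempty
    (fun w : S => {v : E | 0 ≤ ⟪v, (w : E)⟫})
    (fun w => isClosed_le continuous_const (by fun_prop)) (by
      intro F
      obtain ⟨w₀, hw₀⟩ := hS
      let T : Set E := insert w₀ (Subtype.val '' (F : Set S))
      have hTfin : T.Finite := (F.finite_toSet.image _).insert _
      have hTS : T ⊆ S := Set.insert_subset hw₀ (Subtype.coe_image_subset _ _)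
      obtain ⟨v, hvT, hv⟩ := (convex_convexHull ℝ T).exists_mem_forall_inner_pos
        (hTfin.isCompact_convexHull ℝ) ⟨w₀, subset_convexHull ℝ T (Set.mem_insert _ _)⟩
        (fun h => h0 (convexHull_mono hTS h))
      have hvW : v ∈ W := convexHull_min (hTS.trans hSW) W.convex hvT
      have hv0 : v ≠ 0 := fun h => h0 (convexHull_mono hTS (h ▸ hvT))
      refine ⟨‖v‖⁻¹ • v, ⟨?_, W.smul_mem _ hvW⟩, Set.mem_iInter₂.2 fun w hw => ?_⟩
      · simp [norm_smul, hv0]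
      · have := hv w (subset_convexHull ℝ T (Set.mem_insert_of_mem _ ⟨w, hw, rfl⟩))
        simp only [Set.mem_ofPred_eq, real_inner_smul_left]
        positivity)
  refine ⟨v, hvW, ?_, fun w hw => Set.mem_iInter.1 hv ⟨w, hw⟩⟩
  rintro rfl
  simp at hv1

/-- If a self-map of a nonempty compact set has all its displacements in `W`, then the origin is a
convex combination of displacements. -/
lemma IsCompact.zero_mem_convexHull_displacement [FiniteDimensional ℝ E] (φ : E → E)
    (W : Submodule ℝ E) {X : Set E} (hX : IsCompact X) (hne : X.Nonempty)
    (hφ : ∀ x ∈ X, φ x ∈ X) (hW : ∀ x ∈ X, φ x - x ∈ W) :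
    (0 : E) ∈ convexHull ℝ {y | ∃ x ∈ X, y = φ x - x} := by
  induction W using WellFoundedLT.induction generalizing X with
  | ind W ih =>
    by_contra h0
    obtain ⟨x₀, hx₀⟩ := hne
    obtain ⟨v, hvW, hv0, hv⟩ := exists_ne_zero_forall_inner_nonneg (S := {y | ∃ x ∈ X, y = φ x - x})
      ⟨φ x₀ - x₀, x₀, hx₀, rfl⟩ W
      (by rintro _ ⟨x, hx, rfl⟩; exact hW x hx) h0
    have hle : ∀ x ∈ X, ⟪v, x⟫ ≤ ⟪v, φ x⟫ := fun x hx => by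
      simpa [inner_sub_right] using hv _ ⟨x, hx, rfl⟩
    obtain ⟨m, hm, hmax⟩ := hX.exists_isMaxOn ⟨x₀, hx₀⟩
      (f := fun x => ⟪v, x⟫) (by fun_prop)
    let Y : Set E := X ∩ {x | ⟪v, x⟫ = ⟪v, m⟫}
    have hY : ∀ x ∈ Y, φ x ∈ Y := fun x hx =>
      ⟨hφ x hx.1, (hmax (hφ x hx.1)).antisymm (hx.2.symm.le.trans (hle x hx.1))⟩
    have hlt : W ⊓ (ℝ ∙ v)ᗮ < W := by
      refine inf_le_left.lt_of_ne fun h => hv0 ?_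
      have hmem : v ∈ W ⊓ (ℝ ∙ v)ᗮ := h.symm.le hvW
      exact inner_self_eq_zero.1 (Submodule.mem_orthogonal_singleton_iff_inner_right.1 hmem.2)
    have hmem := ih _ hlt (X := Y)
      (hX.inter_right (isClosed_eq (by fun_prop) continuous_const)) ⟨m, hm, rfl⟩ hY
      fun x hx => ⟨hW x hx.1, Submodule.mem_orthogonal_singleton_iff_inner_right.2 <| by
        rw [inner_sub_right, (hY x hx).2, hx.2, sub_self]⟩
    exact h0 (convexHull_mono (by rintro _ ⟨x, hx, rfl⟩; exact ⟨x, hx.1, rfl⟩) hmem)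

end Separation

/-- Every endomorphism of a nonempty convex compact set `X ⊆ ℝ^d` admits an exact
expected fixed point: `0` lies in the convex hull of `{φ x - x : x ∈ X}`. -/
theorem exists_exact_expected_fixed_point
    (d : ℕ) (X : Set (EuclideanSpace ℝ (Fin d)))
    (hXne : X.Nonempty) (hXconv : Convex ℝ X) (hXcomp : IsCompact X)
    (φ : EuclideanSpace ℝ (Fin d) → EuclideanSpace ℝ (Fin d))
    (hφ : ∀ x ∈ X, φ x ∈ X) :
    (0 : EuclideanSpace ℝ (Fin d)) ∈ convexHull ℝ {y | ∃ x ∈ X, y = φ x - x} :=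
  hXcomp.zero_mem_convexHull_displacement φ ⊤ hXne hφ fun _ _ => Submodule.mem_top
end

section
/- Let X ⊆ ℝ^d, let T ∈ ℕ, and let ε ≥ 0. For each t = 1,…,T let u^(t) ∈ ℝ^d satisfy ‖u^(t)‖_∞ ≤ 1, let φ^(t) : X → ℝ^d be a function, and let μ^(t) be a finitely supported probability distribution on X such that ‖E_{x∼μ^(t)}[φ^(t)(x) − x]‖₁ ≤ ε (i.e., μ^(t) is an ε-expected fixed point of φ^(t)). Then for every function φ : X → ℝ^d, Σ_{t=1}^T ⟨u^(t), E_{x∼μ^(t)}[φ(x) − x]⟩ ≤ Σ_{t=1}^T E_{x∼μ^(t)}[⟨φ(x) − φ^(t)(x), u^(t)⟩] + εT. Consequently, for any family Φ of maps X → X, the Φ-regret sup_{φ∈Φ} Σ_{t=1}^T ⟨u^(t), E_{x∼μ^(t)}[φ(x) − x]⟩ is at most the external regret sup_{φ∈Φ} Σ_{t=1}^T E_{x∼μ^(t)}[⟨φ(x) − φ^(t)(x), u^(t)⟩] plus εT. -/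
open scoped RealInnerProductSpace
open Finset

/-- Hölder's inequality for the pair `ℓ₁`, `ℓ_∞`, with the sup norm bounded by `1`. -/
theorem EuclideanSpace.abs_real_inner_le_sum_abs {ι : Type*} [Fintype ι]
    (u v : EuclideanSpace ℝ ι) (hu : ∀ i, |u i| ≤ 1) : |⟪u, v⟫| ≤ ∑ i, |v i| := by
  rw [PiLp.inner_apply]
  refine (abs_sum_le_sum_abs _ _).trans (sum_le_sum fun i _ => ?_)
  rw [Real.inner_apply, abs_mul]
  exact mul_le_of_le_one_left (abs_nonneg _) (hu i)

/-- If each round's mixed strategy `μ^(t)` (points `x t j` with weights `lam t j`) is an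
`ε`-expected fixed point of `φ^(t)` in the `ℓ₁` norm, and each utility vector has sup norm
at most `1`, then the `Φ`-regret against any deviation `φ` is bounded by the corresponding
external regret plus `ε T`. -/
theorem phi_regret_le_external_regret_of_expected_fixed_points
    (d T : ℕ) (X : Set (EuclideanSpace ℝ (Fin d))) (ε : ℝ) (hε : 0 ≤ ε)
    (u : Fin T → EuclideanSpace ℝ (Fin d))
    (hu : ∀ t, ∀ i, |u t i| ≤ 1)
    (φt : Fin T → EuclideanSpace ℝ (Fin d) → EuclideanSpace ℝ (Fin d))
    (m : Fin T → ℕ)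
    (x : ∀ t : Fin T, Fin (m t) → EuclideanSpace ℝ (Fin d))
    (hx : ∀ t j, x t j ∈ X)
    (lam : ∀ t : Fin T, Fin (m t) → ℝ)
    (hlam : ∀ t j, 0 ≤ lam t j)
    (hlamsum : ∀ t, ∑ j, lam t j = 1)
    (hefp : ∀ t, ∑ i, |(∑ j, lam t j • (φt t (x t j) - x t j)) i| ≤ ε) :
    ∀ φ : EuclideanSpace ℝ (Fin d) → EuclideanSpace ℝ (Fin d),
      ∑ t, ⟪u t, ∑ j, lam t j • (φ (x t j) - x t j)⟫ ≤
        (∑ t, ∑ j, lam t j * ⟪φ (x t j) - φt t (x t j), u t⟫) + ε * T := by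
  intro φ
  have key : ∀ t, ⟪u t, ∑ j, lam t j • (φ (x t j) - x t j)⟫ ≤
      (∑ j, lam t j * ⟪φ (x t j) - φt t (x t j), u t⟫) + ε := by
    intro t
    have hsplit : ⟪u t, ∑ j, lam t j • (φ (x t j) - x t j)⟫ =
        (∑ j, lam t j * ⟪φ (x t j) - φt t (x t j), u t⟫) +
          ⟪u t, ∑ j, lam t j • (φt t (x t j) - x t j)⟫ := by
      simp only [inner_sum, inner_smul_right, ← sum_add_distrib]
      refine sum_congr rfl fun j _ => ?_
      rw [real_inner_comm (u t) (φ (x t j) - φt t (x t j)), ← mul_add, ← inner_add_right, sub_add_sub_cancel]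
    rw [hsplit]
    gcongr
    exact (le_abs_self _).trans
      ((EuclideanSpace.abs_real_inner_le_sum_abs _ _ (hu t)).trans (hefp t))
  refine (sum_le_sum fun t _ => key t).trans_eq ?_
  simp [sum_add_distrib, mul_comm]
end

section
/- Let X be a real random variable on a probability space such that E[X] = 0, E[X²] = 1, and |X| ≤ R almost surely for some R > 0 (necessarily R ≥ 1). Then P[X ≥ 1/R] > 0. -/
open MeasureTheory

/-- If a real random variable `X` has mean `0`, second moment `1`, and `|X| ≤ R` almost
surely, then `X ≥ 1/R` with positive probability. -/
theorem prob_pos_of_mean_zero_var_one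
    {Ω : Type*} [MeasurableSpace Ω] (P : Measure Ω) [IsProbabilityMeasure P]
    (X : Ω → ℝ) (hXmeas : Measurable X)
    (R : ℝ) (hR : 0 < R)
    (hbdd : ∀ᵐ ω ∂P, |X ω| ≤ R)
    (hmean : ∫ ω, X ω ∂P = 0)
    (hvar : ∫ ω, (X ω) ^ 2 ∂P = 1) :
    0 < P {ω | 1 / R ≤ X ω} := by
  rw [pos_iff_ne_zero]
  intro h0
  have hlt : ∀ᵐ ω ∂P, X ω < 1 / R := by
    have h : ∀ᵐ ω ∂P, ¬ 1 / R ≤ X ω := by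
      rw [ae_iff]
      simpa only [not_not] using h0
    filter_upwards [h] with ω hω using not_le.mp hω
  have hX : Integrable X P :=
    Integrable.of_bound hXmeas.aestronglyMeasurable R hbdd
  have hX2 : Integrable (fun ω => X ω ^ 2) P := by
    refine Integrable.of_bound (hXmeas.pow_const 2).aestronglyMeasurable (R ^ 2) ?_
    filter_upwards [hbdd] with ω hω
    rw [Real.norm_eq_abs, abs_pow]
    gcongr
  have hexpand : (fun ω => (1 / R - X ω) * (X ω + R)) =
      fun ω => 1 + (1 / R - R) * X ω - X ω ^ 2 := by
    funext ω
    field_simp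
    ring
  have hlin : Integrable (fun ω => 1 + (1 / R - R) * X ω) P :=
    (integrable_const 1).add (hX.const_mul _)
  have hint : Integrable (fun ω => (1 / R - X ω) * (X ω + R)) P := by
    rw [hexpand]
    exact hlin.sub hX2
  have hzero : ∫ ω, (1 / R - X ω) * (X ω + R) ∂P = 0 := by
    rw [hexpand, integral_sub hlin hX2,
      integral_add (integrable_const 1) (hX.const_mul _), integral_const_mul, hmean, hvar]
    simp
  have hnonneg : 0 ≤ᵐ[P] fun ω => (1 / R - X ω) * (X ω + R) := by
    filter_upwards [hlt, hbdd] with ω h1 h2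
    exact mul_nonneg (sub_nonneg.mpr h1.le) (by linarith [(abs_le.mp h2).1])
  have hconst : X =ᵐ[P] fun _ => -R := by
    filter_upwards [(integral_eq_zero_iff_of_nonneg_ae hnonneg hint).mp hzero, hlt]
      with ω h1 h2
    rcases mul_eq_zero.mp h1 with h | h <;> linarith
  rw [integral_congr_ae hconst] at hmean
  simp at hmean
  exact hR.ne' hmean
end

section
/- Let S ⊆ ℝ^d be a compact set, let μ be a Borel probability measure on S, and let m : S → ℝ^k be a continuous map satisfying: (i) ∫ m(x) dμ(x) = 0; (ii) ∫ m(x) m(x)ᵀ dμ(x) = I_{k×k} (the identity matrix, i.e., ∫ ⟨v, m(x)⟩² dμ(x) = ‖v‖² for every v ∈ ℝ^k); and (iii) ‖m(x)‖ ≤ M for all x ∈ S, for some M > 0. Then the closed Euclidean ball B_{1/M}(0) ⊆ ℝ^k is contained in the convex hull of the image m(S). -/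
open MeasureTheory Metric
open scoped RealInnerProductSpace

/-- In a finite-dimensional space, the convex hull of a compact set is compact. -/
theorem IsCompact.isCompact_convexHull_of_finiteDimensional {E : Type*} [NormedAddCommGroup E]
    [NormedSpace ℝ E] [FiniteDimensional ℝ E] {s : Set E} (hs : IsCompact s) :
    IsCompact (convexHull ℝ s) := by
  let I := Fin (Module.finrank ℝ E + 1)
  let comb : (I → ℝ) × (I → E) → E := fun p => ∑ i, p.1 i • p.2 i
  suffices h : convexHull ℝ s = comb '' (stdSimplex ℝ I ×ˢ Set.univ.pi fun _ => s) by
    rw [h]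
    exact ((isCompact_stdSimplex ℝ I).prod (isCompact_univ_pi fun _ => hs)).image (by fun_prop)
  apply Set.Subset.antisymm
  · intro x hx
    obtain ⟨a, ha⟩ := convexHull_nonempty_iff.1 ⟨x, hx⟩
    obtain ⟨ι, _, z, w, hzs, hz, hw, hw1, rfl⟩ := eq_pos_convex_span_of_mem_convexHull hx
    obtain ⟨e⟩ : Nonempty (ι ↪ I) := Function.Embedding.nonempty_of_card_le <| by
      rw [Fintype.card_fin]
      exact hz.card_le_finrank_succ.trans (Nat.succ_le_succ (Submodule.finrank_le _))
    refine ⟨(Function.extend e w 0, Function.extend e z fun _ => a), ⟨⟨fun j => ?_, ?_⟩,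
      fun j _ => ?_⟩, ?_⟩
    · by_cases hj : ∃ i, e i = j
      · obtain ⟨i, rfl⟩ := hj
        simpa [e.injective.extend_apply] using (hw i).le
      · simp [Function.extend_apply' _ _ _ hj]
    · rw [← hw1]
      refine (Fintype.sum_of_injective e e.injective _ _ (fun j hj => ?_) fun i => ?_).symm
      · simp [Function.extend_apply' _ _ _ hj]
      · simp [e.injective.extend_apply]
    · by_cases hj : ∃ i, e i = j
      · obtain ⟨i, rfl⟩ := hj
        simpa [e.injective.extend_apply] using hzs ⟨i, rfl⟩
      · simpa [Function.extend_apply' _ _ _ hj] using ha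
    · refine (Fintype.sum_of_injective e e.injective _ _ (fun j hj => ?_) fun i => ?_).symm
      · simp [Function.extend_apply' _ _ _ hj]
      · simp [e.injective.extend_apply]
  · rintro _ ⟨p, ⟨hw, hz⟩, rfl⟩
    exact (convex_convexHull ℝ s).sum_mem (fun i _ => hw.1 i) hw.2
      fun i _ => subset_convexHull ℝ s (hz i trivial)

/-- A centered random variable with values in `[-c, u]` has second moment at most `u * c`. -/
theorem integral_sq_le_mul_of_ae_mem_Icc {Ω : Type*} [MeasurableSpace Ω] {μ : Measure Ω}
    [IsProbabilityMeasure μ] {X : Ω → ℝ} {u c : ℝ} (hX : Integrable X μ)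
    (hX2 : Integrable (fun x => X x ^ 2) μ) (hmean : ∫ x, X x ∂μ = 0)
    (hmem : ∀ᵐ x ∂μ, X x ∈ Set.Icc (-c) u) : ∫ x, X x ^ 2 ∂μ ≤ u * c := by
  have hle : ∫ x, X x ^ 2 ∂μ ≤ ∫ x, (u - c) * X x + u * c ∂μ := by
    refine integral_mono_ae hX2 ((hX.const_mul _).add (integrable_const _)) ?_
    filter_upwards [hmem] with x hx
    nlinarith [mul_nonneg (sub_nonneg.2 hx.1) (sub_nonneg.2 hx.2)]
  rwa [integral_add (hX.const_mul _) (integrable_const _), integral_const_mul, hmean,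
    integral_const, probReal_univ, mul_zero, zero_add, one_smul] at hle

/-- If a continuous map `m : S → ℝ^k` on a compact set `S`, bounded by `M`, has mean `0`
and identity second-moment matrix with respect to a Borel probability measure supported on
`S`, then the ball `B_{1/M}(0)` is contained in the convex hull of `m(S)`. -/
theorem ball_subset_convexHull_of_isotropic
    (d k : ℕ) (S : Set (EuclideanSpace ℝ (Fin d))) (hScomp : IsCompact S)
    (μ : Measure (EuclideanSpace ℝ (Fin d))) [IsProbabilityMeasure μ]
    (hμS : μ Sᶜ = 0)
    (m : EuclideanSpace ℝ (Fin d) → EuclideanSpace ℝ (Fin k))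
    (hmcont : ContinuousOn m S)
    (M : ℝ) (hM : 0 < M)
    (hmM : ∀ x ∈ S, ‖m x‖ ≤ M)
    (hmean : ∫ x, m x ∂μ = 0)
    (hcov : ∀ v : EuclideanSpace ℝ (Fin k), ∫ x, ⟪v, m x⟫ ^ 2 ∂μ = ‖v‖ ^ 2) :
    closedBall (0 : EuclideanSpace ℝ (Fin k)) (1 / M) ⊆ convexHull ℝ (m '' S) := by
  intro y hy
  by_contra hyS
  have hae : ∀ᵐ x ∂μ, x ∈ S := hμS
  have hrestrict : μ.restrict S = μ := Measure.restrict_eq_self_of_ae_mem hae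
  have integrable_of_continuousOn {F : Type} [NormedAddCommGroup F]
      {g : EuclideanSpace ℝ (Fin d) → F} (hg : ContinuousOn g S) : Integrable g μ := by
    simpa only [IntegrableOn, hrestrict] using hg.integrableOn_compact (μ := μ) hScomp
  obtain ⟨x₀, hx₀⟩ := hae.exists
  have hclosed : IsClosed (convexHull ℝ (m '' S)) :=
    (hScomp.image_of_continuousOn hmcont).isCompact_convexHull_of_finiteDimensional.isClosed
  obtain ⟨f, u, hfu, huy⟩ :=
    geometric_hahn_banach_closed_point (convex_convexHull ℝ _) hclosed hyS
  obtain ⟨v, rfl⟩ := (InnerProductSpace.toDual ℝ _).surjective f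
  simp only [InnerProductSpace.toDual_apply_apply] at hfu huy
  have hmu (x) (hx : x ∈ S) : ⟪v, m x⟫ < u :=
    hfu _ (subset_convexHull ℝ _ (Set.mem_image_of_mem m hx))
  have hv : 0 < ‖v‖ := by
    refine norm_pos_iff.2 fun hv => ?_
    have := (hmu x₀ hx₀).trans huy
    simp [hv] at this
  have hXcont : ContinuousOn (fun x => ⟪v, m x⟫) S := continuousOn_const.inner hmcont
  have hsq := integral_sq_le_mul_of_ae_mem_Icc (c := ‖v‖ * M) (u := u)
    (integrable_of_continuousOn hXcont) (integrable_of_continuousOn (hXcont.pow 2))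
    (by rw [integral_inner (integrable_of_continuousOn hmcont), hmean, inner_zero_right])
    (by
      filter_upwards [hae] with x hx
      refine ⟨?_, (hmu x hx).le⟩
      exact (neg_le_neg (mul_le_mul_of_nonneg_left (hmM x hx) hv.le)).trans
        (neg_le_of_abs_le (abs_real_inner_le_norm v (m x))))
  rw [hcov] at hsq
  have huM : ‖v‖ ≤ u * M := le_of_mul_le_mul_left (by linarith) hv
  have hyM : ‖y‖ * M ≤ 1 := (le_div_iff₀ hM).1 (mem_closedBall_zero_iff.1 hy)
  have huv : u * M < ‖v‖ * ‖y‖ * M :=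
    mul_lt_mul_of_pos_right (huy.trans_le (real_inner_le_norm v y)) hM
  nlinarith
end

section
/- (Shell gradient descent guarantee.) Let Φ ⊆ ℝ^k be nonempty, let D > 0, η > 0, and T ∈ ℕ. Let Ỹ^(1),…,Ỹ^(T+1) ⊆ ℝ^k be nonempty closed convex sets satisfying Φ ⊆ Ỹ^(t) ⊆ B_D(0) for every t. Let U^(0) := 0 and let U^(1),…,U^(T) ∈ ℝ^k be arbitrary. Define iterates by choosing any y^(0) ∈ Ỹ^(1) and setting y^(t) := Π_{Ỹ^(t)}(y^(t−1) + η U^(t−1)) for t = 1,…,T+1, where Π_C denotes Euclidean projection onto the closed convex set C. Then sup_{y* ∈ Φ} Σ_{t=1}^T ⟨y* − y^(t), U^(t)⟩ ≤ 2D²/η + (η/2) Σ_{t=1}^T ‖U^(t)‖². -/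
open Metric Finset
open scoped RealInnerProductSpace

/-- A nearest point of a convex set to `z` is at least as close as `z` to every point of the
set. -/
theorem Convex.norm_sub_le_of_forall_norm_sub_le {E : Type*} [NormedAddCommGroup E]
    [InnerProductSpace ℝ E] {K : Set E} (hK : Convex ℝ K) {z p : E} (hp : p ∈ K)
    (hmin : ∀ w ∈ K, ‖p - z‖ ≤ ‖w - z‖) {w : E} (hw : w ∈ K) : ‖p - w‖ ≤ ‖z - w‖ := by
  have hinf : ‖z - p‖ = ⨅ w : K, ‖z - w‖ := by
    have : Nonempty K := ⟨⟨p, hp⟩⟩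
    refine le_antisymm (le_ciInf fun w => ?_) ?_
    · rw [norm_sub_rev z p, norm_sub_rev z w]
      exact hmin w w.2
    · exact ciInf_le (f := fun w : K => ‖z - w‖)
        ⟨0, by rintro _ ⟨w, rfl⟩; exact norm_nonneg _⟩ ⟨p, hp⟩
  have hinner := (norm_eq_iInf_iff_real_inner_le_zero hK hp).1 hinf w hw
  have hsq : ‖z - w‖ ^ 2 = ‖z - p‖ ^ 2 - 2 * ⟪z - p, w - p⟫ + ‖p - w‖ ^ 2 := by
    rw [norm_sub_rev p w, ← norm_sub_sq_real, sub_sub_sub_cancel_right]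
  refine le_of_sq_le_sq ?_ (norm_nonneg _)
  nlinarith [sq_nonneg ‖z - p‖]

/-- One projected gradient step bounds the instantaneous regret by the decrease of the squared
distance to the comparator. -/
theorem Convex.two_mul_inner_le_of_forall_norm_sub_le {E : Type*} [NormedAddCommGroup E]
    [InnerProductSpace ℝ E] {K : Set E} (hK : Convex ℝ K) {x u p w : E} {η : ℝ} (hp : p ∈ K)
    (hmin : ∀ v ∈ K, ‖p - (x + η • u)‖ ≤ ‖v - (x + η • u)‖) (hw : w ∈ K) :
    2 * η * ⟪w - x, u⟫ ≤ ‖x - w‖ ^ 2 - ‖p - w‖ ^ 2 + η ^ 2 * ‖u‖ ^ 2 := by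
  have hsq : ‖p - w‖ ^ 2 ≤ ‖x + η • u - w‖ ^ 2 :=
    pow_le_pow_left₀ (norm_nonneg _) (hK.norm_sub_le_of_forall_norm_sub_le hp hmin hw) 2
  rw [add_sub_right_comm, norm_add_sq_real, real_inner_smul_right, norm_smul, mul_pow,
    Real.norm_eq_abs, sq_abs, ← neg_sub w x, inner_neg_left, norm_neg, norm_sub_rev w x] at hsq
  linarith

/-- Shell gradient descent guarantee: projected gradient descent with respect to a
time-varying sequence of closed convex "shell" sets `Ỹ^(t)`, each satisfying
`Φ ⊆ Ỹ^(t) ⊆ B_D(0)`, incurs external regret at most `2D²/η + (η/2) Σ_t ‖U^(t)‖²`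
against any comparator in `Φ`. -/
theorem shell_gradient_descent_regret
    (k : ℕ) (Φ : Set (EuclideanSpace ℝ (Fin k))) (hΦne : Φ.Nonempty)
    (D η : ℝ) (hD : 0 < D) (hη : 0 < η) (T : ℕ)
    (Y : ℕ → Set (EuclideanSpace ℝ (Fin k)))
    (hYne : ∀ t, 1 ≤ t → t ≤ T + 1 → (Y t).Nonempty)
    (hYcl : ∀ t, 1 ≤ t → t ≤ T + 1 → IsClosed (Y t))
    (hYconv : ∀ t, 1 ≤ t → t ≤ T + 1 → Convex ℝ (Y t))
    (hΦY : ∀ t, 1 ≤ t → t ≤ T + 1 → Φ ⊆ Y t)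
    (hYD : ∀ t, 1 ≤ t → t ≤ T + 1 → Y t ⊆ closedBall 0 D)
    (U : ℕ → EuclideanSpace ℝ (Fin k)) (hU0 : U 0 = 0)
    (y : ℕ → EuclideanSpace ℝ (Fin k)) (hy0 : y 0 ∈ Y 1)
    -- `y t` is the Euclidean projection of `y (t-1) + η U (t-1)` onto `Y t`
    (hproj : ∀ t, 1 ≤ t → t ≤ T + 1 → y t ∈ Y t ∧
      ∀ w ∈ Y t, ‖y t - (y (t - 1) + η • U (t - 1))‖ ≤ ‖w - (y (t - 1) + η • U (t - 1))‖) :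
    ∀ ystar ∈ Φ, ∑ t ∈ Icc 1 T, ⟪ystar - y t, U t⟫ ≤
      2 * D ^ 2 / η + η / 2 * ∑ t ∈ Icc 1 T, ‖U t‖ ^ 2 := by
  intro ystar hystar
  have htelescope : ∀ n ≤ T, 2 * η * ∑ t ∈ Icc 1 n, ⟪ystar - y t, U t⟫ ≤
      ‖y 1 - ystar‖ ^ 2 - ‖y (n + 1) - ystar‖ ^ 2 + η ^ 2 * ∑ t ∈ Icc 1 n, ‖U t‖ ^ 2 := by
    intro n
    induction n with
    | zero => simp
    | succ n ih =>
      intro hn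
      obtain ⟨hmem, hmin⟩ := hproj (n + 2) (by omega) (by omega)
      have hstep := (hYconv (n + 2) (by omega) (by omega)).two_mul_inner_le_of_forall_norm_sub_le
        hmem hmin (hΦY (n + 2) (by omega) (by omega) hystar)
      rw [show n + 2 - 1 = n + 1 by omega] at hstep
      rw [sum_Icc_succ_top (by omega), sum_Icc_succ_top (by omega), mul_add, mul_add]
      linarith [ih (by omega)]
  have hdiam : ‖y 1 - ystar‖ ≤ 2 * D := by
    have hy1 := hYD 1 le_rfl (by omega) (hproj 1 le_rfl (by omega)).1
    have hs := hYD 1 le_rfl (by omega) (hΦY 1 le_rfl (by omega) hystar)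
    rw [mem_closedBall_zero_iff] at hy1 hs
    linarith [norm_sub_le (y 1) ystar]
  have hdiam_sq := pow_le_pow_left₀ (norm_nonneg _) hdiam 2
  have hbound : 2 * η * ∑ t ∈ Icc 1 T, ⟪ystar - y t, U t⟫ ≤
      2 * η * (2 * D ^ 2 / η + η / 2 * ∑ t ∈ Icc 1 T, ‖U t‖ ^ 2) := by
    have hrhs : 2 * η * (2 * D ^ 2 / η + η / 2 * ∑ t ∈ Icc 1 T, ‖U t‖ ^ 2) =
        (2 * D) ^ 2 + η ^ 2 * ∑ t ∈ Icc 1 T, ‖U t‖ ^ 2 := by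
      field_simp
    rw [hrhs]
    linarith [htelescope T le_rfl, sq_nonneg ‖y (T + 1) - ystar‖]
  exact le_of_mul_le_mul_left hbound (by positivity)
end
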